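/- (Skew-Hermiticity of the Fourier–Galerkin convection matrix.) Let L_x, L_y > 0 and let n₁, n₂ be positive integers. Let K := {(c,d) ∈ ℤ² : |c| ≤ n₁, |d| ≤ n₂} be the index set and let w : K → ℂ satisfy the conjugacy condition w_{−p,−q} = conj(w_{p,q}) for all (p,q) ∈ K, and w_{0,0} = 0. Define the K×K complex matrix B(w) by B(w)_{(c,d),(n,m)} := −w_{c−n, d−m} · ((c−n)·m − (d−m)·n) · L_x·L_y / ((c−n)²·L_y² + (d−m)²·L_x²) whenever (c−n, d−m) ∈ K and (c−n, d−m) ≠ (0,0), and B(w)_{(c,d),(n,m)} := 0 otherwise. Then B(w) is skew-Hermitian: conj(B(w)_{(n,m),(c,d)}) = −B(w)_{(c,d),(n,m)} for all (c,d), (n,m) ∈ K. -/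

import Mathlib

/-- **Skew-Hermiticity of the Fourier–Galerkin convection matrix.**
Let `K = {(c,d) ∈ ℤ² : |c| ≤ n₁, |d| ≤ n₂}` and let `w` satisfy the conjugacy
condition `w₋ₚ,₋q = conj(w_{p,q})` on `K` and `w₀,₀ = 0`.  The matrix
`B(w)_{(c,d),(n,m)} = −w_{c−n,d−m}·((c−n)m − (d−m)n)·LxLy/((c−n)²Ly² + (d−m)²Lx²)`
(zero when `(c−n,d−m) ∉ K` or `(c−n,d−m) = (0,0)`) is skew-Hermitian on `K`:
`conj(B(w)_{(n,m),(c,d)}) = −B(w)_{(c,d),(n,m)}`. -/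
theorem FG_convection_matrix_skewHermitian
    (Lx Ly : ℝ) (hLx : 0 < Lx) (hLy : 0 < Ly)
    (n₁ n₂ : ℕ) (hn₁ : 0 < n₁) (hn₂ : 0 < n₂)
    (w : ℤ × ℤ → ℂ)
    (hconj : ∀ p q : ℤ, |p| ≤ (n₁ : ℤ) → |q| ≤ (n₂ : ℤ) →
      w (-p, -q) = starRingEnd ℂ (w (p, q)))
    (hw0 : w (0, 0) = 0)
    (Bw : (ℤ × ℤ) → (ℤ × ℤ) → ℂ)
    (hBw : ∀ c d n m : ℤ, Bw (c, d) (n, m) =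
      if (|c - n| ≤ (n₁ : ℤ) ∧ |d - m| ≤ (n₂ : ℤ)) ∧ ¬(c - n = 0 ∧ d - m = 0) then
        -w (c - n, d - m) * (((c - n) * m - (d - m) * n : ℤ) : ℂ) * ((Lx : ℂ) * (Ly : ℂ))
          / (((c - n : ℤ) : ℂ) ^ 2 * (Ly : ℂ) ^ 2 + ((d - m : ℤ) : ℂ) ^ 2 * (Lx : ℂ) ^ 2)
      else 0) :
    ∀ c d n m : ℤ, |c| ≤ (n₁ : ℤ) → |d| ≤ (n₂ : ℤ) → |n| ≤ (n₁ : ℤ) → |m| ≤ (n₂ : ℤ) →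
      starRingEnd ℂ (Bw (n, m) (c, d)) = -Bw (c, d) (n, m) := by
  intro c d n m _ _ _ _
  rw [hBw, hBw]
  by_cases h : (|c - n| ≤ (n₁ : ℤ) ∧ |d - m| ≤ (n₂ : ℤ)) ∧ ¬(c - n = 0 ∧ d - m = 0)
  · have h' : (|n - c| ≤ (n₁ : ℤ) ∧ |m - d| ≤ (n₂ : ℤ)) ∧ ¬(n - c = 0 ∧ m - d = 0) := by
      rw [abs_sub_comm n c, abs_sub_comm m d]
      exact ⟨h.1, fun k => h.2 ⟨by omega, by omega⟩⟩
    rw [if_pos h, if_pos h']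
    have e := hconj (n - c) (m - d) h'.1.1 h'.1.2
    rw [neg_sub, neg_sub] at e
    rw [e]
    simp only [map_div₀, map_mul, map_neg, map_add, map_pow, Complex.conj_ofReal, map_intCast]
    rw [← neg_div]
    congr 1
    · push_cast; ring
    · push_cast; ring
  · have h' : ¬ ((|n - c| ≤ (n₁ : ℤ) ∧ |m - d| ≤ (n₂ : ℤ)) ∧ ¬(n - c = 0 ∧ m - d = 0)) := by
      rw [abs_sub_comm n c, abs_sub_comm m d]
      exact fun k => h ⟨k.1, fun k' => k.2 ⟨by omega, by omega⟩⟩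
    rw [if_neg h, if_neg h']
    simp
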